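/- arXiv:1908.08121 — 3 statements merged into one kernel-verified Lean document; each statement's English description precedes it below -/
import Mathlib

section
/- Let T be an infinite locally finite rooted tree of bounded degree, let b ∈ [0,1), and for each k let T_k be the subtree induced by the vertices within distance k of the root, with vertex set V_k and Δ_k the ℓ² norm of the descendant generating function of T_k with parameter b. Then Δ_k = o(|V_k|) as k → ∞. -/
open MeasureTheory ProbabilityTheory Filter Topology
open scoped ENNReal NNReal

/-- A rooted tree on vertex type `V`, encoded by its root and parent function:
every vertex reaches the root by iterating `parent`, and the root is a fixed
point of `parent`. -/
structure ParentTree (V : Type*) where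
  root : V
  parent : V → V
  parent_root : parent root = root
  reaches_root : ∀ v : V, ∃ n : ℕ, parent^[n] v = root

namespace ParentTree

variable {V : Type*} (T : ParentTree V)

/-- The depth of a vertex: its graph distance to the root. -/
noncomputable def depth (v : V) : ℕ := sInf {n : ℕ | T.parent^[n] v = T.root}

lemma depth_spec (v : V) : T.parent^[T.depth v] v = T.root :=
  Nat.sInf_mem (T.reaches_root v)

lemma depth_root : T.depth T.root = 0 :=
  Nat.eq_zero_of_le_zero (Nat.sInf_le (by simp))

lemma depth_parent_le (v : V) : T.depth (T.parent v) ≤ T.depth v := by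
  have hspec := T.depth_spec v
  cases h : T.depth v with
  | zero =>
      rw [h] at hspec
      simp only [Function.iterate_zero, id_eq] at hspec
      subst hspec
      simp [T.parent_root, T.depth_root]
  | succ m =>
      rw [h, Function.iterate_succ_apply] at hspec
      exact (Nat.sInf_le hspec).trans (Nat.le_succ m)

/-- `Desc T r v` is the set of descendants of `v` exactly `r` generations below `v`. -/
def Desc (r : ℕ) (v : V) : Set V :=
  {w : V | T.parent^[r] w = v ∧ T.depth w = T.depth v + r}

/-- The set of children of a vertex. -/
def children (v : V) : Set V := {w : V | w ≠ T.root ∧ T.parent w = v}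

/-- The graph distance between two vertices of the tree. -/
noncomputable def tdist (v w : V) : ℕ :=
  sInf {k : ℕ | ∃ n m : ℕ, n + m = k ∧ T.parent^[n] v = T.parent^[m] w}

/-- The descendant generating function `δ(v) = ∑_r |D_r(v)| bʳ`. -/
noncomputable def dgf (b : ℝ) (v : V) : ℝ :=
  ∑' r : ℕ, (Nat.card (T.Desc r v) : ℝ) * b ^ r

/-- `Δ = ‖δ‖_{ℓ²(V)}` for a finite tree. -/
noncomputable def Delta [Fintype V] (b : ℝ) : ℝ :=
  Real.sqrt (∑ v : V, T.dgf b v ^ 2)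

/-- Upper growth rate `limsup_r |D_r(ρ)|^{1/r}`. -/
noncomputable def bargr : ℝ≥0∞ :=
  Filter.atTop.limsup fun r : ℕ => (Nat.card (T.Desc r T.root) : ℝ≥0∞) ^ (1 / (r : ℝ))

/-- Maximum local growth rate `limsup_r max_v |D_r(v)|^{1/r}`. -/
noncomputable def maxgr : ℝ≥0∞ :=
  Filter.atTop.limsup fun r : ℕ => ⨆ v : V, (Nat.card (T.Desc r v) : ℝ≥0∞) ^ (1 / (r : ℝ))

/-- The parent map of the depth-`k` truncation. -/
noncomputable def truncParent (k : ℕ) (v : {v : V // T.depth v ≤ k}) :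
    {v : V // T.depth v ≤ k} :=
  ⟨T.parent v.1, le_trans (T.depth_parent_le v.1) v.2⟩

lemma truncParent_iterate (k n : ℕ) (v : {v : V // T.depth v ≤ k}) :
    ((T.truncParent k)^[n] v).1 = T.parent^[n] v.1 := by
  induction n generalizing v with
  | zero => rfl
  | succ n ih =>
      rw [Function.iterate_succ_apply, Function.iterate_succ_apply]
      exact ih _

/-- The subtree induced by the vertices within distance `k` of the root. -/
noncomputable def trunc (k : ℕ) : ParentTree {v : V // T.depth v ≤ k} where
  root := ⟨T.root, by simp [T.depth_root]⟩
  parent := T.truncParent k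
  parent_root := Subtype.ext T.parent_root
  reaches_root := fun v => by
    obtain ⟨n, hn⟩ := T.reaches_root v.1
    exact ⟨n, Subtype.ext (by rw [truncParent_iterate, hn])⟩

end ParentTree

namespace ParentTree

lemma sum_card_le_card_of_pairwise_disjoint {ι W : Type*} [Fintype W] (s : Finset ι)
    (A : ι → Set W) (hA : Pairwise (Function.onFun Disjoint A)) :
    ∑ i ∈ s, Nat.card (A i) ≤ Fintype.card W := by
  classical
  calc ∑ i ∈ s, Nat.card (A i) = ∑ i ∈ s, (A i).toFinset.card := by
        simp [Nat.card_eq_fintype_card, Set.toFinset_card]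
    _ = (s.biUnion fun i => (A i).toFinset).card := by
        rw [Finset.card_biUnion]
        intro i _ j _ hij
        exact Set.disjoint_toFinset.2 (hA hij)
    _ ≤ Fintype.card W := Finset.card_le_univ _

section Finite

variable {W : Type*} (S : ParentTree W) {b : ℝ}

lemma Desc_succ_subset (r : ℕ) (v : W) :
    S.Desc (r + 1) v ⊆ ⋃ u ∈ S.Desc r v, S.children u := by
  rintro w ⟨hw, hd⟩
  have hroot : w ≠ S.root := by
    rintro rfl
    rw [S.depth_root] at hd
    omega
  simp only [Set.mem_iUnion]
  refine ⟨S.parent w, ⟨by rwa [Function.iterate_succ_apply] at hw, ?_⟩, hroot, rfl⟩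
  have hspec := S.depth_spec w
  rw [hd, ← add_assoc, Function.iterate_succ_apply] at hspec
  have h1 : S.depth (S.parent w) ≤ S.depth v + r := Nat.sInf_le hspec
  have h2 : S.depth w ≤ S.depth (S.parent w) + 1 := by
    refine Nat.sInf_le ?_
    change S.parent^[_] w = S.root
    rw [Function.iterate_succ_apply, S.depth_spec]
  omega

lemma dgf_nonneg (hb0 : 0 ≤ b) (v : W) : 0 ≤ S.dgf b v :=
  tsum_nonneg fun r => by positivity

variable [Fintype W]

lemma sum_card_Desc_vertices_le (r : ℕ) :
    ∑ v : W, Nat.card (S.Desc r v) ≤ Fintype.card W := by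
  refine sum_card_le_card_of_pairwise_disjoint _ _ fun v w hvw => ?_
  exact Set.disjoint_left.2 fun x hx hy => hvw (hx.1.symm.trans hy.1)

lemma sum_card_Desc_generations_le (v : W) (s : Finset ℕ) :
    ∑ r ∈ s, Nat.card (S.Desc r v) ≤ Fintype.card W := by
  refine sum_card_le_card_of_pairwise_disjoint _ _ fun i j hij => ?_
  refine Set.disjoint_left.2 fun x hx hy => hij ?_
  have := hx.2.symm.trans hy.2
  omega

lemma card_Desc_le_card (r : ℕ) (v : W) : Nat.card (S.Desc r v) ≤ Fintype.card W := by
  simpa using S.sum_card_Desc_generations_le v {r}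

lemma card_Desc_le_pow {d : ℕ} (hd : ∀ v, Nat.card (S.children v) ≤ d) (r : ℕ) (v : W) :
    Nat.card (S.Desc r v) ≤ d ^ r := by
  classical
  induction r with
  | zero =>
    have : S.Desc 0 v ⊆ {v} := fun w hw => hw.1
    simpa using Nat.card_mono (Set.toFinite _) this
  | succ r ih =>
    have key : (S.Desc (r + 1) v).toFinset ⊆
        (S.Desc r v).toFinset.biUnion fun u => (S.children u).toFinset := by
      intro w hw
      simpa using S.Desc_succ_subset r v (by simpa using hw)
    have h2 := (Finset.card_le_card key).trans (Finset.card_biUnion_le_card_mul _ _ d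
      fun u _ => by simpa [Nat.card_eq_fintype_card, Set.toFinset_card] using hd u)
    rw [Set.toFinset_card, Set.toFinset_card, ← Nat.card_eq_fintype_card,
      ← Nat.card_eq_fintype_card] at h2
    rw [pow_succ]
    exact h2.trans (Nat.mul_le_mul_right d ih)

lemma summable_dgf (hb0 : 0 ≤ b) (hb1 : b < 1) (v : W) :
    Summable fun r : ℕ => (Nat.card (S.Desc r v) : ℝ) * b ^ r := by
  refine Summable.of_nonneg_of_le (fun r => by positivity) (fun r => ?_)
    ((summable_geometric_of_lt_one hb0 hb1).mul_left (Fintype.card W : ℝ))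
  gcongr
  exact S.card_Desc_le_card r v

lemma sum_dgf_le (hb0 : 0 ≤ b) (hb1 : b < 1) :
    ∑ v : W, S.dgf b v ≤ Fintype.card W * (1 - b)⁻¹ := by
  unfold dgf
  rw [← Summable.tsum_finsetSum fun v _ => S.summable_dgf hb0 hb1 v,
    ← tsum_geometric_of_lt_one hb0 hb1, ← tsum_mul_left]
  refine Summable.tsum_le_tsum (fun r => ?_) (summable_sum fun v _ => S.summable_dgf hb0 hb1 v)
    ((summable_geometric_of_lt_one hb0 hb1).mul_left _)
  rw [← Finset.sum_mul]
  gcongr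
  exact_mod_cast S.sum_card_Desc_vertices_le r

lemma dgf_le {d : ℕ} (hd : ∀ v, Nat.card (S.children v) ≤ d) (hb0 : 0 ≤ b) (hb1 : b < 1)
    (R : ℕ) (v : W) :
    S.dgf b v ≤ ∑ r ∈ Finset.range R, (d : ℝ) ^ r + b ^ R * Fintype.card W := by
  refine Real.tsum_le_of_sum_range_le (fun r => by positivity) fun N => ?_
  calc ∑ r ∈ Finset.range N, (Nat.card (S.Desc r v) : ℝ) * b ^ r
      ≤ ∑ r ∈ Finset.range N,
          ((if r < R then (d : ℝ) ^ r else 0) + b ^ R * Nat.card (S.Desc r v)) := by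
        refine Finset.sum_le_sum fun r _ => ?_
        split_ifs with h
        · have h1 : (Nat.card (S.Desc r v) : ℝ) ≤ (d : ℝ) ^ r := by
            exact_mod_cast S.card_Desc_le_pow hd r v
          have h2 : (Nat.card (S.Desc r v) : ℝ) * b ^ r ≤ Nat.card (S.Desc r v) :=
            mul_le_of_le_one_right (by positivity) (pow_le_one₀ hb0 hb1.le)
          have h3 : 0 ≤ b ^ R * (Nat.card (S.Desc r v) : ℝ) := by positivity
          linarith
        · rw [zero_add, mul_comm]
          gcongr ?_ * _
          exact pow_le_pow_of_le_one hb0 hb1.le (not_lt.1 h)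
    _ ≤ _ := by
        rw [Finset.sum_add_distrib, ← Finset.mul_sum, ← Finset.sum_filter]
        gcongr
        · intro r hr
          simpa using (Finset.mem_filter.1 hr).2
        · exact_mod_cast S.sum_card_Desc_generations_le v _

lemma sum_dgf_sq_le {d : ℕ} (hd : ∀ v, Nat.card (S.children v) ≤ d) (hb0 : 0 ≤ b)
    (hb1 : b < 1) (R : ℕ) :
    ∑ v : W, S.dgf b v ^ 2 ≤
      (∑ r ∈ Finset.range R, (d : ℝ) ^ r + b ^ R * Fintype.card W) *
        (Fintype.card W * (1 - b)⁻¹) := by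
  calc ∑ v : W, S.dgf b v ^ 2
      ≤ ∑ v : W, (∑ r ∈ Finset.range R, (d : ℝ) ^ r + b ^ R * Fintype.card W) * S.dgf b v := by
        refine Finset.sum_le_sum fun v _ => ?_
        rw [sq]
        exact mul_le_mul_of_nonneg_right (S.dgf_le hd hb0 hb1 R v) (S.dgf_nonneg hb0 v)
    _ ≤ _ := by
        rw [← Finset.mul_sum]
        gcongr
        exact S.sum_dgf_le hb0 hb1

end Finite

variable {V : Type*} (T : ParentTree V)

lemma card_children_trunc_le {k : ℕ} (v : {v : V // T.depth v ≤ k})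
    (hfin : (T.children v.1).Finite) :
    Nat.card ((T.trunc k).children v) ≤ Nat.card (T.children v.1) := by
  have := hfin.to_subtype
  refine Nat.card_le_card_of_injective
    (fun w : (T.trunc k).children v => (⟨w.1.1, fun h => w.2.1 (Subtype.ext h),
      congrArg Subtype.val w.2.2⟩ : T.children v.1)) fun x y hxy => ?_
  simpa [Subtype.ext_iff] using hxy

lemma tendsto_card_trunc [Infinite V] [∀ k : ℕ, Fintype {v : V // T.depth v ≤ k}] :
    Tendsto (fun k : ℕ => Fintype.card {v : V // T.depth v ≤ k}) atTop atTop := by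
  refine tendsto_atTop.2 fun N => ?_
  obtain ⟨s, hs⟩ := Infinite.exists_subset_card_eq V N
  filter_upwards [eventually_ge_atTop (s.sup T.depth)] with k hk
  rw [← hs, ← Fintype.card_coe]
  refine Fintype.card_le_of_injective
    (fun x : s => (⟨x.1, (Finset.le_sup x.2).trans hk⟩ : {v : V // T.depth v ≤ k}))
    fun x y hxy => ?_
  exact Subtype.ext (Subtype.mk.inj hxy)

end ParentTree

/-- **Theorem (first part of the growth-rate theorem).** If `T` is an infinite, locally
finite rooted tree of bounded degree and `b ∈ [0,1)`, then `Δ_k = o(|V_k|)`, where `Δ_k`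
is the `ℓ²` norm of the descendant generating function of the depth-`k` truncation `T_k`
and `V_k` is its vertex set. -/
theorem delta_little_o_of_bounded_degree
    {V : Type} [Infinite V] (T : ParentTree V)
    [∀ k : ℕ, Fintype {v : V // T.depth v ≤ k}]
    (hdeg : ∃ d : ℕ, ∀ v : V, (T.children v).Finite ∧ Nat.card (T.children v) ≤ d)
    {b : ℝ} (hb0 : 0 ≤ b) (hb1 : b < 1) :
    Filter.Tendsto
      (fun k : ℕ => (T.trunc k).Delta b / (Fintype.card {v : V // T.depth v ≤ k} : ℝ))
      Filter.atTop (nhds 0) := by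
  obtain ⟨d, hd⟩ := hdeg
  have hcard : Tendsto (fun k : ℕ => (Fintype.card {v : V // T.depth v ≤ k} : ℝ)) atTop atTop :=
    tendsto_natCast_atTop_atTop.comp T.tendsto_card_trunc
  have hb : 0 < 1 - b := sub_pos.2 hb1
  suffices h : Tendsto (fun k : ℕ => (∑ v, (T.trunc k).dgf b v ^ 2) /
      (Fintype.card {v : V // T.depth v ≤ k} : ℝ) ^ 2) atTop (𝓝 0) by
    have h' := h.sqrt
    rw [Real.sqrt_zero] at h'
    refine h'.congr fun k => ?_
    rw [Real.sqrt_div' _ (by positivity), Real.sqrt_sq (by positivity)]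
    rfl
  refine tendsto_order.2 ⟨fun a ha => Eventually.of_forall fun k => ha.trans_le (by positivity),
    fun ε hε => ?_⟩
  obtain ⟨R, hR⟩ := exists_pow_lt_of_lt_one (mul_pos hε hb) hb1
  have hlim : Tendsto (fun k : ℕ => ((∑ r ∈ Finset.range R, (d : ℝ) ^ r) /
      (Fintype.card {v : V // T.depth v ≤ k} : ℝ) + b ^ R) * (1 - b)⁻¹) atTop
      (𝓝 ((0 + b ^ R) * (1 - b)⁻¹)) :=
    ((hcard.const_div_atTop _).add_const _).mul_const _
  have hlt : (0 + b ^ R) * (1 - b)⁻¹ < ε := by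
    rwa [zero_add, ← div_eq_mul_inv, div_lt_iff₀ hb]
  filter_upwards [hlim.eventually_lt_const hlt, hcard.eventually_gt_atTop 0] with k hk hpos
  refine lt_of_le_of_lt ?_ hk
  rw [div_le_iff₀ (by positivity)]
  refine ((T.trunc k).sum_dgf_sq_le (fun v => (T.card_children_trunc_le v (hd v.1).1).trans
    (hd v.1).2) hb0 hb1 R).trans_eq ?_
  field_simp
end

section
/- Let T = (V,E) be a finite rooted tree and define Q : ℓ²(V) → ℓ²(V) by Qf(v) = ∑_{w : π(w)=v} f(w). Then for every j ≥ 0 the operator norm of Q^j equals √(max_{v∈V} |D_j(v)|). -/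
open MeasureTheory ProbabilityTheory Filter Topology
open scoped ENNReal NNReal

namespace ParentTree

variable {V : Type*} (T : ParentTree V)

lemma depth_eq_depth_parent_add_one {v : V} (hv : v ≠ T.root) :
    T.depth v = T.depth (T.parent v) + 1 := by
  apply le_antisymm
  · refine Nat.sInf_le ?_
    change T.parent^[T.depth (T.parent v) + 1] v = T.root
    rw [Function.iterate_succ_apply]
    exact T.depth_spec _
  · have hspec := T.depth_spec v
    cases h : T.depth v with
    | zero =>
        rw [h] at hspec
        exact absurd hspec hv
    | succ m =>
        rw [h, Function.iterate_succ_apply] at hspec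
        exact Nat.succ_le_succ (Nat.sInf_le hspec)

lemma mem_Desc_zero {v w : V} : w ∈ T.Desc 0 v ↔ w = v := by
  constructor
  · exact fun h => h.1
  · rintro rfl
    exact ⟨rfl, rfl⟩

lemma mem_Desc_succ {j : ℕ} {v w : V} :
    w ∈ T.Desc (j + 1) v ↔ w ≠ T.root ∧ T.parent w ∈ T.Desc j v := by
  simp only [Desc, Set.mem_ofPred_eq, Function.iterate_succ_apply]
  constructor
  · rintro ⟨h, hd⟩
    have hw : w ≠ T.root := by
      rintro rfl
      rw [T.depth_root] at hd
      omega
    have := T.depth_eq_depth_parent_add_one hw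
    exact ⟨hw, h, by omega⟩
  · rintro ⟨hw, h, hd⟩
    have := T.depth_eq_depth_parent_add_one hw
    exact ⟨h, by omega⟩

open Classical in
/-- The descendants `j` generations below `v` in a finite tree, as a finset. -/
noncomputable def descFinset [Fintype V] (j : ℕ) (v : V) : Finset V :=
  Finset.univ.filter (· ∈ T.Desc j v)

@[simp]
lemma mem_descFinset [Fintype V] {j : ℕ} {v w : V} :
    w ∈ T.descFinset j v ↔ w ∈ T.Desc j v := by
  simp [descFinset]

lemma card_descFinset [Fintype V] (j : ℕ) (v : V) :
    (T.descFinset j v).card = Nat.card (T.Desc j v) := by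
  classical
  rw [Nat.card_eq_fintype_card, Fintype.card_of_subtype]
  exact fun w => T.mem_descFinset

lemma sum_sum_descFinset_le [Fintype V] (j : ℕ) {g : V → ℝ} (hg : ∀ w, 0 ≤ g w) :
    ∑ v, ∑ w ∈ T.descFinset j v, g w ≤ ∑ w, g w := by
  classical
  rw [← Finset.sum_biUnion]
  · exact Finset.sum_le_sum_of_subset_of_nonneg (Finset.subset_univ _) fun w _ _ => hg w
  · intro u _ v _ huv
    refine Finset.disjoint_left.2 fun w hu hv => huv ?_
    rw [mem_descFinset] at hu hv
    exact hu.1.symm.trans hv.1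

lemma pow_apply_eq_sum_descFinset [Fintype V] [DecidableEq V]
    {Q : EuclideanSpace ℝ V →L[ℝ] EuclideanSpace ℝ V}
    (hQ : ∀ (f : EuclideanSpace ℝ V) (v : V),
      Q f v = ∑ w ∈ Finset.univ.filter (fun w => w ≠ T.root ∧ T.parent w = v), f w)
    (j : ℕ) (f : EuclideanSpace ℝ V) (v : V) :
    (Q ^ j) f v = ∑ w ∈ T.descFinset j v, f w := by
  induction j generalizing f with
  | zero =>
      have : T.descFinset 0 v = {v} := by
        ext w
        simp [mem_Desc_zero]
      simp [this]
  | succ j ih =>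
      rw [pow_succ, mul_apply_eq_comp, ih]
      have hmaps : ∀ w ∈ T.descFinset (j + 1) v, T.parent w ∈ T.descFinset j v := by
        intro w hw
        rw [mem_descFinset, mem_Desc_succ] at hw
        exact T.mem_descFinset.2 hw.2
      rw [← Finset.sum_fiberwise_of_maps_to hmaps]
      refine Finset.sum_congr rfl fun u hu => ?_
      rw [hQ]
      refine Finset.sum_congr ?_ fun _ _ => rfl
      ext w
      simp only [Finset.mem_filter, Finset.mem_univ, true_and, mem_descFinset,
        mem_Desc_succ] at hu ⊢
      constructor
      · rintro ⟨hw, rfl⟩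
        exact ⟨⟨hw, hu⟩, rfl⟩
      · rintro ⟨⟨hw, -⟩, h⟩
        exact ⟨hw, h⟩

end ParentTree

/-- **Proposition (operator norm of powers of the child-sum operator).** Let `T` be a
finite rooted tree and `Q` the operator on `ℓ²(V)` given by `Qf(v) = ∑_{w child of v} f(w)`.
Then `‖Q^j‖ = √(max_v |D_j(v)|)` for every `j`. -/
theorem opNorm_child_operator_pow
    {V : Type} [Fintype V] [DecidableEq V] (T : ParentTree V)
    (Q : EuclideanSpace ℝ V →L[ℝ] EuclideanSpace ℝ V)
    (hQ : ∀ (f : EuclideanSpace ℝ V) (v : V),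
      Q f v = ∑ w ∈ Finset.univ.filter (fun w => w ≠ T.root ∧ T.parent w = v), f w)
    (j : ℕ) :
    ‖Q ^ j‖ = Real.sqrt ((Finset.univ.sup fun v => Nat.card (T.Desc j v) : ℕ) : ℝ) := by
  set M : ℕ := Finset.univ.sup fun v => Nat.card (T.Desc j v) with hM
  have hcard : ∀ v, (T.descFinset j v).card ≤ M := fun v => by
    rw [T.card_descFinset]
    exact Finset.le_sup (f := fun v => Nat.card (T.Desc j v)) (Finset.mem_univ v)
  apply le_antisymm
  · refine ContinuousLinearMap.opNorm_le_bound _ (Real.sqrt_nonneg _) fun f => ?_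
    rw [← Real.sqrt_sq (norm_nonneg f), ← Real.sqrt_mul (Nat.cast_nonneg M)]
    apply Real.le_sqrt_of_sq_le
    rw [EuclideanSpace.real_norm_sq_eq, EuclideanSpace.real_norm_sq_eq]
    calc ∑ v, (Q ^ j) f v ^ 2
        ≤ ∑ v, (M : ℝ) * ∑ w ∈ T.descFinset j v, f w ^ 2 := by
          refine Finset.sum_le_sum fun v _ => ?_
          rw [T.pow_apply_eq_sum_descFinset hQ]
          refine sq_sum_le_card_mul_sum_sq.trans ?_
          gcongr
          exact hcard v
      _ = M * ∑ v, ∑ w ∈ T.descFinset j v, f w ^ 2 := (Finset.mul_sum _ _ _).symm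
      _ ≤ M * ∑ w, f w ^ 2 := by
          refine mul_le_mul_of_nonneg_left ?_ (Nat.cast_nonneg M)
          exact T.sum_sum_descFinset_le j fun w => sq_nonneg (f w)
  · obtain ⟨v, -, hv⟩ := Finset.exists_mem_eq_sup Finset.univ ⟨T.root, Finset.mem_univ _⟩
      fun v => Nat.card (T.Desc j v)
    rw [← hM, ← T.card_descFinset] at hv
    let f : EuclideanSpace ℝ V := WithLp.toLp 2 fun w => if w ∈ T.descFinset j v then 1 else 0
    have hf : ‖f‖ = √(M : ℝ) := by
      rw [EuclideanSpace.norm_eq, hv]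
      simp [f]
    have hQf : (Q ^ j) f v = M := by
      rw [T.pow_apply_eq_sum_descFinset hQ, hv]
      simp [f]
    have hle : (M : ℝ) ≤ ‖Q ^ j‖ * √(M : ℝ) := by
      calc (M : ℝ) = ‖(Q ^ j) f v‖ := by rw [hQf, Real.norm_natCast]
        _ ≤ ‖(Q ^ j) f‖ := PiLp.norm_apply_le _ v
        _ ≤ ‖Q ^ j‖ * ‖f‖ := (Q ^ j).le_opNorm f
        _ = ‖Q ^ j‖ * √(M : ℝ) := by rw [hf]
    rcases (Real.sqrt_nonneg (M : ℝ)).eq_or_lt with h0 | hpos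
    · rw [← h0]
      exact norm_nonneg _
    · refine le_of_mul_le_mul_right ?_ hpos
      rwa [Real.mul_self_sqrt (Nat.cast_nonneg M)]
end

section
/- For any finite rooted tree T = (V,E) and b ∈ [0,1), one has ∑_{(w₁,w₂)∈V²} b^{d(w₁,w₂)} ≤ Δ² ≤ (1/(1−b²)) · ∑_{(w₁,w₂)∈V²} b^{d(w₁,w₂)}, where Δ is the ℓ² norm of the descendant generating function of T with parameter b and d is the graph distance. -/
open MeasureTheory ProbabilityTheory Filter Topology
open scoped ENNReal NNReal

namespace ParentTree

variable {V : Type*} (T : ParentTree V)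

lemma iterate_parent_root (n : ℕ) : T.parent^[n] T.root = T.root :=
  Function.iterate_fixed T.parent_root n

lemma depth_le_of_iterate_eq_root {n : ℕ} {v : V} (h : T.parent^[n] v = T.root) :
    T.depth v ≤ n :=
  Nat.sInf_le h

lemma iterate_parent_eq_root {n : ℕ} {v : V} (h : T.depth v ≤ n) :
    T.parent^[n] v = T.root := by
  obtain ⟨k, rfl⟩ := Nat.exists_eq_add_of_le' h
  rw [Function.iterate_add_apply, T.depth_spec, T.iterate_parent_root]

lemma depth_iterate_parent (n : ℕ) (v : V) : T.depth (T.parent^[n] v) = T.depth v - n := by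
  apply le_antisymm
  · apply T.depth_le_of_iterate_eq_root
    rw [← Function.iterate_add_apply]
    exact T.iterate_parent_eq_root (by omega)
  · have h := T.depth_spec (T.parent^[n] v)
    rw [← Function.iterate_add_apply] at h
    have := T.depth_le_of_iterate_eq_root h
    omega

lemma iterate_parent_min_depth (n : ℕ) (v : V) :
    T.parent^[min n (T.depth v)] v = T.parent^[n] v := by
  rcases le_total n (T.depth v) with h | h
  · rw [min_eq_left h]
  · rw [min_eq_right h, T.depth_spec, T.iterate_parent_eq_root h]

/-- `v` is an ancestor of `w`, or `w` itself. -/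
def IsAncestor (v w : V) : Prop :=
  T.depth v ≤ T.depth w ∧ T.parent^[T.depth w - T.depth v] w = v

lemma isAncestor_iterate_parent (n : ℕ) (w : V) : T.IsAncestor (T.parent^[n] w) w := by
  have h := T.depth_iterate_parent n w
  refine ⟨by omega, ?_⟩
  rw [h, ← T.iterate_parent_min_depth n]
  congr 2
  omega

lemma IsAncestor.eq_of_depth_eq {T : ParentTree V} {u v w : V} (hu : T.IsAncestor u w)
    (hv : T.IsAncestor v w) (h : T.depth u = T.depth v) : u = v := by
  rw [← hu.2, ← hv.2, h]

lemma mem_Desc_iff {r : ℕ} {v w : V} :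
    w ∈ T.Desc r v ↔ T.IsAncestor v w ∧ T.depth w - T.depth v = r := by
  constructor
  · rintro ⟨h, hd⟩
    have hr : T.depth w - T.depth v = r := by omega
    exact ⟨⟨by omega, by rw [hr, h]⟩, hr⟩
  · rintro ⟨⟨hle, h⟩, rfl⟩
    exact ⟨h, by omega⟩

lemma tdist_le_of_isAncestor {T : ParentTree V} {u v w : V} (hv : T.IsAncestor u v)
    (hw : T.IsAncestor u w) :
    T.tdist v w ≤ (T.depth v - T.depth u) + (T.depth w - T.depth u) :=
  Nat.sInf_le ⟨_, _, rfl, hv.2.trans hw.2.symm⟩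

/-- The distance between two vertices is realised through a common ancestor. -/
lemma exists_isAncestor_tdist_eq (v w : V) :
    ∃ u, T.IsAncestor u v ∧ T.IsAncestor u w ∧
      T.tdist v w = (T.depth v - T.depth u) + (T.depth w - T.depth u) := by
  have hne : {k : ℕ | ∃ n m : ℕ, n + m = k ∧ T.parent^[n] v = T.parent^[m] w}.Nonempty :=
    ⟨_, T.depth v, T.depth w, rfl, (T.depth_spec v).trans (T.depth_spec w).symm⟩
  obtain ⟨n, m, hnm, h⟩ := Nat.sInf_mem hne
  change n + m = T.tdist v w at hnm
  have hv : T.IsAncestor (T.parent^[n] v) v := T.isAncestor_iterate_parent n v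
  have hw : T.IsAncestor (T.parent^[n] v) w := h ▸ T.isAncestor_iterate_parent m w
  have hle := tdist_le_of_isAncestor hv hw
  have hn := T.depth_iterate_parent n v
  have hm := T.depth_iterate_parent m w
  rw [← h] at hm
  exact ⟨_, hv, hw, by omega⟩

open Classical in
lemma dgf_eq_sum [Fintype V] (b : ℝ) (v : V) :
    T.dgf b v = ∑ w, if T.IsAncestor v w then b ^ (T.depth w - T.depth v) else 0 := by
  have hterm (r : ℕ) : (Nat.card (T.Desc r v) : ℝ) * b ^ r =
      ∑ w, if T.depth w - T.depth v = r then
        (if T.IsAncestor v w then b ^ (T.depth w - T.depth v) else 0) else 0 := by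
    rw [Nat.card_eq_fintype_card, Fintype.card_subtype, ← nsmul_eq_mul, ← Finset.sum_const,
      Finset.sum_filter]
    refine Finset.sum_congr rfl fun w _ => ?_
    simp only [mem_Desc_iff]
    split_ifs <;> simp_all
  unfold dgf
  simp_rw [hterm]
  rw [Summable.tsum_finsetSum fun w _ => (hasSum_ite_eq' _ _).summable]
  exact Finset.sum_congr rfl fun w _ => tsum_ite_eq' _ _

open Classical in
lemma Delta_sq_eq_sum [Fintype V] (b : ℝ) :
    T.Delta b ^ 2 = ∑ w : V × V, ∑ u, if T.IsAncestor u w.1 ∧ T.IsAncestor u w.2 then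
      b ^ ((T.depth w.1 - T.depth u) + (T.depth w.2 - T.depth u)) else 0 := by
  rw [Delta, Real.sq_sqrt (Finset.sum_nonneg fun v _ => sq_nonneg _), Finset.sum_comm]
  refine Finset.sum_congr rfl fun v _ => ?_
  rw [dgf_eq_sum, sq, Finset.sum_mul_sum, Fintype.sum_prod_type]
  refine Finset.sum_congr rfl fun w₁ _ => Finset.sum_congr rfl fun w₂ _ => ?_
  rw [ite_and]
  split_ifs <;> simp [pow_add]

open Classical in
lemma pow_tdist_le_sum [Fintype V] {b : ℝ} (hb : 0 ≤ b) (v w : V) :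
    b ^ T.tdist v w ≤ ∑ u, if T.IsAncestor u v ∧ T.IsAncestor u w then
      b ^ ((T.depth v - T.depth u) + (T.depth w - T.depth u)) else 0 := by
  obtain ⟨m, hv, hw, hd⟩ := T.exists_isAncestor_tdist_eq v w
  refine le_trans (le_of_eq ?_) (Finset.single_le_sum (fun u _ => ?_) (Finset.mem_univ m))
  · rw [if_pos ⟨hv, hw⟩, hd]
  · positivity

open Classical in
lemma sum_le_inv_mul_pow_tdist [Fintype V] {b : ℝ} (hb0 : 0 ≤ b) (hb1 : b < 1) (v w : V) :
    (∑ u, if T.IsAncestor u v ∧ T.IsAncestor u w then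
      b ^ ((T.depth v - T.depth u) + (T.depth w - T.depth u)) else 0) ≤
      (1 - b ^ 2)⁻¹ * b ^ T.tdist v w := by
  obtain ⟨m, hv, hw, hd⟩ := T.exists_isAncestor_tdist_eq v w
  have hdepth {u : V} (hu : T.IsAncestor u v ∧ T.IsAncestor u w) : T.depth u ≤ T.depth m := by
    have := tdist_le_of_isAncestor hu.1 hu.2
    have := hu.1.1
    have := hu.2.1
    have := hv.1
    have := hw.1
    omega
  have hsq : b ^ 2 < 1 := by nlinarith
  rw [← Finset.sum_filter]
  calc _ = ∑ u with T.IsAncestor u v ∧ T.IsAncestor u w,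
        (b ^ 2) ^ (T.depth m - T.depth u) * b ^ T.tdist v w := by
        refine Finset.sum_congr rfl fun u hu => ?_
        have hu := (Finset.mem_filter.1 hu).2
        have := hdepth hu
        have := hv.1
        have := hw.1
        rw [← pow_mul, ← pow_add]
        congr 1
        omega
    _ = (∑ k ∈ Finset.image (fun u => T.depth m - T.depth u)
          {u | T.IsAncestor u v ∧ T.IsAncestor u w}, (b ^ 2) ^ k) * b ^ T.tdist v w := by
        rw [← Finset.sum_mul, Finset.sum_image]
        intro x hx y hy hxy
        have hx := (Finset.mem_filter.1 hx).2
        have hy := (Finset.mem_filter.1 hy).2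
        have := hdepth hx
        have := hdepth hy
        dsimp only at hxy
        exact hx.1.eq_of_depth_eq hy.1 (by omega)
    _ ≤ _ := by
        gcongr
        rw [← tsum_geometric_of_lt_one (sq_nonneg b) hsq]
        exact (summable_geometric_of_lt_one (sq_nonneg b) hsq).sum_le_tsum _
          fun k _ => by positivity

end ParentTree

/-- **Proposition (two-sided bound for `Δ²`).** For any finite rooted tree and
`b ∈ [0,1)`, `∑_{(w₁,w₂)∈V²} b^{d(w₁,w₂)} ≤ Δ² ≤ (1/(1−b²))·∑_{(w₁,w₂)∈V²} b^{d(w₁,w₂)}`. -/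
theorem delta_sq_bounds
    {V : Type} [Fintype V] (T : ParentTree V)
    {b : ℝ} (hb0 : 0 ≤ b) (hb1 : b < 1) :
    (∑ w : V × V, b ^ T.tdist w.1 w.2) ≤ (T.Delta b) ^ 2 ∧
    (T.Delta b) ^ 2 ≤ (1 - b ^ 2)⁻¹ * ∑ w : V × V, b ^ T.tdist w.1 w.2 := by
  rw [T.Delta_sq_eq_sum, Finset.mul_sum]
  exact ⟨Finset.sum_le_sum fun w _ => T.pow_tdist_le_sum hb0 w.1 w.2,
    Finset.sum_le_sum fun w _ => T.sum_le_inv_mul_pow_tdist hb0 hb1 w.1 w.2⟩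
end
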